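/- arXiv:1606.08338 — 2 statements merged into one kernel-verified Lean document; each statement's English description precedes it below -/
import Mathlib

section
/- Let S = ∪_{e∈E(S)} G_e be a Clifford semigroup such that the idempotent semilattice E(S) is uniformly locally finite. Then ℓ¹(S) is approximately left character biprojective if and only if ℓ¹(S) is pseudo-amenable. -/
open Filter Topology

universe u

/-! ## Nets indexed by directed sets -/

/-- A (nonempty) directed index type, used to index nets. -/
structure DirSys : Type (u + 1) where
  ι : Type u
  [pre : Preorder ι]
  [dir : IsDirected ι (· ≤ ·)]
  [ne : Nonempty ι]

attribute [instance] DirSys.pre DirSys.dir DirSys.ne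

section Core

variable (A : Type u) [NonUnitalNormedRing A] [NormedSpace ℂ A]
  [IsScalarTower ℂ A A] [SMulCommClass ℂ A A]

/-- A realization of the projective tensor product `A ⊗̂ A` of a Banach algebra `A` with
itself, together with its canonical Banach `A`-bimodule structure and the product
(diagonal) map `π_A`.  The field `universal` is the universal property of the projective
tensor norm, which pins the object down uniquely up to isometric isomorphism. -/
structure ProjTensorSq (X : Type u) [NormedAddCommGroup X] [NormedSpace ℂ X]
    [CompleteSpace X] : Type (u + 1) where
  /-- the canonical bilinear map `(a, b) ↦ a ⊗ b` -/
  tmul : A →L[ℂ] A →L[ℂ] X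
  /-- the projective norm is a cross norm -/
  norm_tmul : ∀ a b : A, ‖tmul a b‖ = ‖a‖ * ‖b‖
  /-- elementary tensors span a dense subspace -/
  dense_span : Dense (Submodule.span ℂ (Set.range fun p : A × A => tmul p.1 p.2) : Set X)
  /-- the universal property of the projective tensor product -/
  universal : ∀ (Y : Type u) [NormedAddCommGroup Y] [NormedSpace ℂ Y] [CompleteSpace Y]
      (f : A →L[ℂ] A →L[ℂ] Y), ∃ g : X →L[ℂ] Y, ‖g‖ ≤ ‖f‖ ∧ ∀ a b : A, g (tmul a b) = f a b
  /-- the left module action `a · (b ⊗ c) = (a * b) ⊗ c` -/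
  lsmul : A →L[ℂ] X →L[ℂ] X
  lsmul_tmul : ∀ a b c : A, lsmul a (tmul b c) = tmul (a * b) c
  /-- the right module action `(b ⊗ c) · a = b ⊗ (c * a)` -/
  rsmul : A →L[ℂ] X →L[ℂ] X
  rsmul_tmul : ∀ a b c : A, rsmul a (tmul b c) = tmul b (c * a)
  /-- the product map `π_A`, determined by `π_A (a ⊗ b) = a * b` -/
  projL : X →L[ℂ] A
  projL_tmul : ∀ a b : A, projL (tmul a b) = a * b

variable {A}

/-- `A` is approximately left `φ`-biprojective:  there is a net `(ρ_α)` of bounded linear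
maps `A → A ⊗̂ A` with `a·ρ_α(x) - ρ_α(ax) → 0`, `ρ_α(xa) - φ(a)ρ_α(x) → 0` and
`φ(π_A(ρ_α(x))) → φ(x)` for all `a x : A`. -/
def ApproxLeftBiprojective (φ : WeakDual.characterSpace ℂ A) : Prop :=
  ∀ (X : Type u) [NormedAddCommGroup X] [NormedSpace ℂ X] [CompleteSpace X]
    (P : ProjTensorSq A X),
    ∃ (D : DirSys.{u}) (ρ : D.ι → (A →L[ℂ] X)),
      (∀ a x : A, Tendsto (fun i => P.lsmul a (ρ i x) - ρ i (a * x)) atTop (𝓝 0)) ∧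
      (∀ a x : A, Tendsto (fun i => ρ i (x * a) - φ a • ρ i x) atTop (𝓝 0)) ∧
      (∀ x : A, Tendsto (fun i => φ (P.projL (ρ i x))) atTop (𝓝 (φ x)))

/-- `A` is approximately left character biprojective if it is approximately left
`φ`-biprojective for every character `φ` of `A`. -/
def ApproxLeftCharBiprojective : Prop :=
  ∀ φ : WeakDual.characterSpace ℂ A, ApproxLeftBiprojective φ

/-- `A` is approximately left `φ`-amenable: there is a (not necessarily bounded) net
`(a_α)` in `A` with `‖a * a_α - φ(a) a_α‖ → 0` for every `a` and `φ(a_α) → 1`. -/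
def ApproxLeftAmenable (φ : WeakDual.characterSpace ℂ A) : Prop :=
  ∃ (D : DirSys.{u}) (v : D.ι → A),
    (∀ a : A, Tendsto (fun i => a * v i - φ a • v i) atTop (𝓝 0)) ∧
    Tendsto (fun i => φ (v i)) atTop (𝓝 1)

/-- `A` is approximately biprojective (Zhang): there is a net `(ρ_α)` of bounded
`A`-bimodule morphisms `A → A ⊗̂ A` with `π_A(ρ_α(a)) → a` for every `a`. -/
def ApproxBiprojective : Prop :=
  ∀ (X : Type u) [NormedAddCommGroup X] [NormedSpace ℂ X] [CompleteSpace X]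
    (P : ProjTensorSq A X),
    ∃ (D : DirSys.{u}) (ρ : D.ι → (A →L[ℂ] X)),
      (∀ i, ∀ a b : A, ρ i (a * b) = P.lsmul a (ρ i b)) ∧
      (∀ i, ∀ a b : A, ρ i (a * b) = P.rsmul b (ρ i a)) ∧
      (∀ a : A, Tendsto (fun i => P.projL (ρ i a)) atTop (𝓝 a))

/-- `A` is pseudo-amenable: there is a (not necessarily bounded) net `(m_α)` in `A ⊗̂ A`
with `a·m_α - m_α·a → 0` and `π_A(m_α) a → a` for every `a`. -/
def PseudoAmenable : Prop :=
  ∀ (X : Type u) [NormedAddCommGroup X] [NormedSpace ℂ X] [CompleteSpace X]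
    (P : ProjTensorSq A X),
    ∃ (D : DirSys.{u}) (m : D.ι → X),
      (∀ a : A, Tendsto (fun i => P.lsmul a (m i) - P.rsmul a (m i)) atTop (𝓝 0)) ∧
      (∀ a : A, Tendsto (fun i => P.projL (m i) * a - a) atTop (𝓝 0))

end Core
section SemigroupAlgebra

/-- A model of the semigroup algebra `ℓ¹(S)` of a (discrete) semigroup `S`: a Banach
algebra `A` isometrically isomorphic, as a Banach space, to `ℓ¹(S)`, whose
multiplication corresponds to the convolution
`(f * g)(s) = ∑_{uv = s} f(u) g(v)`. -/
structure L1SemigroupModel (S : Type) [Semigroup S] (A : Type) [NonUnitalNormedRing A]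
    [NormedSpace ℂ A] (T : A ≃ₗᵢ[ℂ] lp (fun _ : S => ℂ) 1) : Prop where
  mul_eq : ∀ (f g : A) (s : S),
    (T (f * g) : ∀ _ : S, ℂ) s =
      ∑' p : {p : S × S // p.1 * p.2 = s}, (T f : ∀ _ : S, ℂ) p.1.1 * (T g : ∀ _ : S, ℂ) p.1.2

end SemigroupAlgebra

section CliffordSemigroups

/-- `S` is a Clifford semigroup with inversion `star`. -/
structure IsCliffordStar (S : Type) [Semigroup S] (star : S → S) : Prop where
  mul_star_mul : ∀ s : S, s * star s * s = s
  star_mul_star : ∀ s : S, star s * s * star s = star s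
  star_unique : ∀ s t : S, s * t * s = s → t * s * t = t → t = star s
  mul_star_comm : ∀ s : S, s * star s = star s * s

namespace IsCliffordStar

variable {S : Type} [Semigroup S] {star : S → S} (h : IsCliffordStar S star)

include h

theorem star_idem {e : S} (he : e * e = e) : star e = e :=
  (h.star_unique e e (by rw [he, he]) (by rw [he, he])).symm

theorem idem_mul_star (s : S) : s * star s * (s * star s) = s * star s := by
  rw [← mul_assoc, h.mul_star_mul]

theorem idem_mul {e f : S} (he : e * e = e) (hf : f * f = f) :
    e * f * (e * f) = e * f := by
  set x := star (e * f) with hx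
  have h1 : e * f * x * (e * f) = e * f := h.mul_star_mul _
  have h2 : x * (e * f) * x = x := h.star_mul_star _
  have h3 : f * x * e = x := by
    refine h.star_unique (e * f) _ ?_ ?_
    · calc e * f * (f * x * e) * (e * f) = e * (f * f) * x * (e * e) * f := by
            simp only [mul_assoc]
        _ = e * f * x * (e * f) := by rw [he, hf]; simp only [mul_assoc]
        _ = e * f := h1
    · calc f * x * e * (e * f) * (f * x * e) = f * x * (e * e) * (f * f) * x * e := by
            simp only [mul_assoc]
        _ = f * (x * (e * f) * x) * e := by rw [he, hf]; simp only [mul_assoc]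
        _ = f * x * e := by rw [h2]
  have h4 : x * x = x := by
    calc x * x = f * x * e * (f * x * e) := by rw [h3]
      _ = f * (x * (e * f) * x) * e := by simp only [mul_assoc]
      _ = x := by rw [h2, h3]
  have h5 : e * f = x := by
    rw [← h.star_idem h4]
    exact h.star_unique x (e * f) h2 h1
  rw [h5, h4]

theorem idem_comm {e f : S} (he : e * e = e) (hf : f * f = f) : e * f = f * e := by
  have h1 := h.idem_mul he hf
  have h2 := h.idem_mul hf he
  rw [← h.star_idem h1]
  symm
  refine h.star_unique _ _ ?_ ?_
  · calc e * f * (f * e) * (e * f) = e * (f * f) * (e * e) * f := by simp only [mul_assoc]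
      _ = e * f := by rw [he, hf, mul_assoc (e * f), h1]
  · calc f * e * (e * f) * (f * e) = f * (e * e) * (f * f) * e := by simp only [mul_assoc]
      _ = f * e := by rw [he, hf, mul_assoc (f * e), h2]

theorem star_mul (s t : S) : star (s * t) = star t * star s := by
  have hc : t * star t * (star s * s) = star s * s * (t * star t) :=
    h.idem_comm (h.idem_mul_star t) (by rw [← h.mul_star_comm]; exact h.idem_mul_star s)
  symm
  refine h.star_unique _ _ ?_ ?_
  · calc s * t * (star t * star s) * (s * t) = s * (t * star t * (star s * s)) * t := by
          simp only [mul_assoc]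
      _ = s * star s * s * (t * star t * t) := by rw [hc]; simp only [mul_assoc]
      _ = s * t := by rw [h.mul_star_mul, h.mul_star_mul]
  · calc star t * star s * (s * t) * (star t * star s)
        = star t * (star s * s * (t * star t)) * star s := by simp only [mul_assoc]
      _ = star t * t * star t * (star s * s * star s) := by rw [← hc]; simp only [mul_assoc]
      _ = star t * star s := by rw [h.star_mul_star, h.star_mul_star]

/-- Idempotents of a Clifford semigroup are central. -/
theorem idem_central {e : S} (he : e * e = e) (s : S) : e * s = s * e := by
  have hs := h.idem_mul_star s
  have h1 : e * (s * star s) = star s * e * s := by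
    have := h.mul_star_comm (e * s)
    rw [h.star_mul, h.star_idem he] at this
    calc e * (s * star s) = e * e * (s * star s) := by rw [he]
      _ = e * (s * star s * e) := by rw [mul_assoc, h.idem_comm he hs]
      _ = e * s * (star s * e) := by simp only [mul_assoc]
      _ = star s * (e * e) * s := by rw [this]; simp only [mul_assoc]
      _ = star s * e * s := by rw [he]
  calc e * s = e * (s * star s) * s := by rw [mul_assoc, h.mul_star_mul]
    _ = s * star s * e * s := by rw [h.idem_comm he hs]
    _ = s * (star s * e * s) := by simp only [mul_assoc]
    _ = s * (e * (s * star s)) := by rw [h1]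
    _ = s * (s * star s * e) := by rw [h.idem_comm he hs]
    _ = s * (star s * s * e) := by rw [h.mul_star_comm]
    _ = s * star s * s * e := by simp only [mul_assoc]
    _ = s * e := by rw [h.mul_star_mul]

theorem mul_mul_star (s t : S) :
    s * t * star (s * t) = s * star s * (t * star t) := by
  rw [h.star_mul]
  calc s * t * (star t * star s) = s * (t * star t * star s) := by simp only [mul_assoc]
    _ = s * star s * (t * star t) := by
      rw [h.idem_central (h.idem_mul_star t)]; simp only [mul_assoc]

end IsCliffordStar

end CliffordSemigroups

section EllOne

variable {S : Type} {A : Type} [NonUnitalNormedRing A] [NormedSpace ℂ A]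
  (T : A ≃ₗᵢ[ℂ] lp (fun _ : S => ℂ) 1)

open Classical in
/-- The point mass at `s`. -/
noncomputable def pointMass (s : S) : A := T.symm (lp.single 1 s (1 : ℂ))

open Classical in
theorem coord_pointMass (s t : S) :
    (T (pointMass T s) : ∀ _ : S, ℂ) t = if t = s then 1 else 0 := by
  simp [pointMass, Pi.single_apply]

theorem norm_pointMass (s : S) : ‖pointMass T s‖ = 1 := by
  classical
  simp [pointMass, lp.norm_single]

theorem hasSum_pointMass (a : A) :
    HasSum (fun s => (T a : ∀ _ : S, ℂ) s • pointMass T s) a := by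
  classical
  have h := lp.hasSum_single (p := 1) (by simp) (T a)
  have h2 := h.mapL (T.symm.toContinuousLinearEquiv : _ →L[ℂ] A)
  convert h2 using 1
  · funext s
    have : lp.single 1 s ((T a : ∀ _ : S, ℂ) s) =
        (T a : ∀ _ : S, ℂ) s • lp.single (E := fun _ : S => ℂ) 1 s (1 : ℂ) := by
      rw [← lp.single_smul]; simp
    rw [this]
    simp [pointMass]
  · simp

theorem summable_norm_coord (a : A) : Summable fun s => ‖(T a : ∀ _ : S, ℂ) s‖ := by
  simpa using (lp.memℓp (T a)).summable (by simp)

theorem norm_eq_tsum_coord (a : A) : ‖a‖ = ∑' s, ‖(T a : ∀ _ : S, ℂ) s‖ := by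
  rw [← T.norm_map a, lp.norm_eq_tsum_rpow (by simp)]
  simp

theorem clm_ext_pointMass {Y : Type*} [NormedAddCommGroup Y] [NormedSpace ℂ Y]
    {f g : A →L[ℂ] Y} (h : ∀ s, f (pointMass T s) = g (pointMass T s)) : f = g := by
  ext a
  have hf := (hasSum_pointMass T a).mapL f
  have hg := (hasSum_pointMass T a).mapL g
  simp only [map_smul, h] at hf hg
  exact hf.unique hg

/-- A bounded family of vectors indexed by `S` extends to a bounded linear map on `ℓ¹(S)`. -/
theorem exists_clm_of_bounded {Y : Type*} [NormedAddCommGroup Y] [NormedSpace ℂ Y]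
    [CompleteSpace Y] (x : S → Y) (C : ℝ) (hx : ∀ s, ‖x s‖ ≤ C) :
    ∃ L : A →L[ℂ] Y, (∀ s, L (pointMass T s) = x s) ∧ ∀ a, ‖L a‖ ≤ C * ‖a‖ := by
  classical
  have hb : ∀ (a : A) s, ‖(T a : ∀ _ : S, ℂ) s • x s‖ ≤ C * ‖(T a : ∀ _ : S, ℂ) s‖ := by
    intro a s
    rw [norm_smul, mul_comm]
    gcongr
    exact hx s
  have hs : ∀ a : A, Summable fun s => (T a : ∀ _ : S, ℂ) s • x s := fun a =>
    Summable.of_norm_bounded ((summable_norm_coord T a).mul_left C) (hb a)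
  let L₀ : A →ₗ[ℂ] Y :=
    { toFun := fun a => ∑' s, (T a : ∀ _ : S, ℂ) s • x s
      map_add' := fun a b => by
        rw [← (hs a).tsum_add (hs b)]
        simp [add_smul]
      map_smul' := fun c a => by
        rw [RingHom.id_apply, ← (hs a).tsum_const_smul]
        simp [mul_smul] }
  have hL : ∀ a, ‖L₀ a‖ ≤ C * ‖a‖ := fun a => by
    rw [norm_eq_tsum_coord T a, ← tsum_mul_left]
    exact tsum_of_norm_bounded ((summable_norm_coord T a).mul_left C).hasSum (hb a)
  refine ⟨L₀.mkContinuous C hL, fun s => ?_, fun a => hL a⟩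
  change ∑' t, (T (pointMass T s) : ∀ _ : S, ℂ) t • x t = x s
  rw [tsum_eq_single s]
  · simp [coord_pointMass]
  · intro t ht
    simp [coord_pointMass, ht]

/-- A net of operators on `ℓ¹(S)` that is uniformly bounded on point masses and tends to zero on
each point mass tends to zero pointwise. -/
theorem tendsto_zero_of_pointMass {Y : Type*} [NormedAddCommGroup Y] [NormedSpace ℂ Y]
    [CompleteSpace Y] {ι : Type*} {l : Filter ι} (B : ι → A →L[ℂ] Y) (C : ℝ)
    (hC : ∀ i s, ‖B i (pointMass T s)‖ ≤ C)
    (hB : ∀ s, Tendsto (fun i => B i (pointMass T s)) l (𝓝 0)) (a : A) :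
    Tendsto (fun i => B i a) l (𝓝 0) := by
  have h1 : ∀ i, B i a = ∑' s, (T a : ∀ _ : S, ℂ) s • B i (pointMass T s) := fun i => by
    have := (hasSum_pointMass T a).mapL (B i)
    simp only [map_smul] at this
    exact this.tsum_eq.symm
  simp only [h1]
  have h2 : (0 : Y) = ∑' s : S, (0 : Y) := by simp
  rw [h2]
  refine tendsto_tsum_of_dominated_convergence ((summable_norm_coord T a).mul_right C) ?_ ?_
  · intro s
    simpa using (hB s).const_smul ((T a : ∀ _ : S, ℂ) s)
  · refine Eventually.of_forall fun i s => ?_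
    rw [norm_smul]
    gcongr
    exact hC i s

theorem pointMass_mul [Semigroup S] (hA : L1SemigroupModel S A T) (s t : S) :
    pointMass T s * pointMass T t = pointMass T (s * t) := by
  classical
  apply T.injective
  apply lp.ext
  funext u
  rw [hA.mul_eq, coord_pointMass]
  simp only [coord_pointMass]
  by_cases h : u = s * t
  · rw [if_pos h, tsum_eq_single ⟨(s, t), h.symm⟩]
    · simp
    · rintro ⟨⟨p, q⟩, hp⟩ hne
      simp only [ne_eq, Subtype.mk.injEq, Prod.mk.injEq, not_and] at hne
      by_cases hs : p = s
      · simp [hne hs]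
      · simp [hs]
  · rw [if_neg h]
    convert tsum_zero with p
    obtain ⟨⟨p, q⟩, hp⟩ := p
    simp only at hp
    by_cases hs : p = s
    · by_cases ht : q = t
      · subst hs ht
        exact absurd hp.symm h
      · simp [ht]
    · simp [hs]

end EllOne

section ProjectiveTensor

variable {A : Type u} [NonUnitalNormedRing A] [NormedSpace ℂ A]
  [IsScalarTower ℂ A A] [SMulCommClass ℂ A A]
  {X : Type u} [NormedAddCommGroup X] [NormedSpace ℂ X] [CompleteSpace X]

namespace ProjTensorSq

omit [IsScalarTower ℂ A A] [SMulCommClass ℂ A A] in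
theorem clm_ext (P : ProjTensorSq A X) {Y : Type*} [NormedAddCommGroup Y] [NormedSpace ℂ Y]
    {f g : X →L[ℂ] Y} (h : ∀ a b, f (P.tmul a b) = g (P.tmul a b)) : f = g := by
  refine ContinuousLinearMap.ext_on P.dense_span ?_
  rintro _ ⟨p, rfl⟩
  exact h p.1 p.2

theorem projL_lsmul (P : ProjTensorSq A X) (a : A) (x : X) :
    P.projL (P.lsmul a x) = a * P.projL x := by
  have : P.projL ∘L P.lsmul a = ContinuousLinearMap.mul ℂ A a ∘L P.projL :=
    P.clm_ext fun b c => by simp [P.lsmul_tmul, P.projL_tmul, mul_assoc]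
  exact congrArg (fun f => f x) this

end ProjTensorSq

/-- A pseudo-amenable Banach algebra is approximately left character biprojective. -/
theorem PseudoAmenable.approxLeftCharBiprojective [CompleteSpace A]
    (h : PseudoAmenable (A := A)) :
    ApproxLeftCharBiprojective (A := A) := by
  intro φ X _ _ _ P
  obtain ⟨D, m, hm1, hm2⟩ := h X P
  let φL : A →L[ℂ] ℂ := WeakDual.CharacterSpace.toCLM φ
  have hφL : ∀ a, φL a = φ a := fun a => rfl
  have hφmul : ∀ a b, φL (a * b) = φL a * φL b := fun a b => map_mul φ a b
  obtain ⟨x₀, hx₀⟩ : ∃ x₀, φL x₀ = 1 := by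
    have hne : ∃ y, φL y ≠ 0 := by
      by_contra! hcon
      exact φ.2.1 (ContinuousLinearMap.ext hcon)
    obtain ⟨y, hy⟩ := hne
    exact ⟨(φL y)⁻¹ • y, by simp [hy]⟩
  obtain ⟨g, -, hg⟩ := P.universal A (ContinuousLinearMap.smulRightL ℂ A A φL)
  replace hg : ∀ a b, g (P.tmul a b) = φL b • a := hg
  have hgl : ∀ a x, g (P.lsmul a x) = a * g x := fun a x => by
    have : g ∘L P.lsmul a = ContinuousLinearMap.mul ℂ A a ∘L g :=
      P.clm_ext fun b c => by simp [P.lsmul_tmul, hg]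
    exact congrArg (fun f => f x) this
  have hgr : ∀ a x, g (P.rsmul a x) = φL a • g x := fun a x => by
    have : g ∘L P.rsmul a = φL a • g :=
      P.clm_ext fun b c => by simp [P.rsmul_tmul, hg, hφmul, mul_smul, smul_comm (φL a)]
    exact congrArg (fun f => f x) this
  have hgp : ∀ x, φL (g x) = φL (P.projL x) := fun x => by
    have : φL ∘L g = φL ∘L P.projL :=
      P.clm_ext fun b c => by simp [P.projL_tmul, hg, hφmul, mul_comm]
    exact congrArg (fun f => f x) this
  have hn1 : ∀ a, Tendsto (fun i => a * g (m i) - φL a • g (m i)) atTop (𝓝 0) := fun a => by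
    have := (g.continuous.tendsto 0).comp (hm1 a)
    simpa [Function.comp_def, hgl, hgr] using this
  have hn2 : Tendsto (fun i => φL (g (m i))) atTop (𝓝 1) := by
    have := ((φL.continuous.tendsto 0).comp (hm2 x₀)).add_const 1
    simpa [Function.comp_def, hφmul, hx₀, hgp] using this
  refine ⟨D, fun i => φL.smulRight (P.tmul (g (m i)) x₀), fun a x => ?_, fun a x => ?_,
    fun x => ?_⟩
  · have h1 := (((P.tmul.flip x₀).continuous.tendsto 0).comp (hn1 a)).const_smul (φL x)
    simp only [map_zero, smul_zero] at h1
    refine h1.congr fun i => ?_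
    simp [P.lsmul_tmul, hφmul, smul_sub, mul_smul, smul_comm (φL x)]
  · refine tendsto_const_nhds.congr fun i => ?_
    simp [hφmul, mul_smul, ← hφL, smul_comm (φL x)]
  · have h1 := hn2.const_mul (φL x)
    refine (by simpa [hφL] using h1 : Tendsto _ _ (𝓝 (φ x))).congr fun i => ?_
    simp [P.projL_tmul, ← hφL, hφmul, hx₀]

theorem eventually_mem_and_one_div_lt {α : Type*} [DecidableEq α] (a : α) {ε : ℝ} (hε : 0 < ε) :
    ∀ᶠ i : Finset α × ℕ in atTop, a ∈ i.1 ∧ 1 / ((i.2 : ℝ) + 1) < ε := by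
  obtain ⟨n, hn⟩ := exists_nat_one_div_lt hε
  filter_upwards [eventually_ge_atTop (({a}, n) : Finset α × ℕ)] with i hi
  refine ⟨hi.1 (by simp), lt_of_le_of_lt ?_ hn⟩
  have : (n : ℝ) ≤ i.2 := by exact_mod_cast hi.2
  gcongr

/-- Pseudo-amenability follows from finite approximation data. -/
theorem pseudoAmenable_of_finite_approx {A : Type u} [NonUnitalNormedRing A] [NormedSpace ℂ A]
    (h : ∀ (X : Type u) [NormedAddCommGroup X] [NormedSpace ℂ X] [CompleteSpace X]
      (P : ProjTensorSq A X) (K : Finset A) (ε : ℝ), 0 < ε → ∃ m : X, ∀ a ∈ K,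
        ‖P.lsmul a m - P.rsmul a m‖ < ε ∧ ‖P.projL m * a - a‖ < ε) :
    PseudoAmenable (A := A) := by
  classical
  intro X _ _ _ P
  have hpos : ∀ n : ℕ, (0 : ℝ) < 1 / (n + 1) := fun n => by positivity
  choose m hm using fun i : Finset A × ℕ => h X P i.1 (1 / ((i.2 : ℝ) + 1)) (hpos i.2)
  refine ⟨⟨Finset A × ℕ⟩, m, fun a => ?_, fun a => ?_⟩
  · rw [Metric.tendsto_nhds]
    intro ε hε
    filter_upwards [eventually_mem_and_one_div_lt a hε] with i hi
    rw [dist_zero_right]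
    exact (hm i a hi.1).1.trans hi.2
  · rw [Metric.tendsto_nhds]
    intro ε hε
    filter_upwards [eventually_mem_and_one_div_lt a hε] with i hi
    rw [dist_zero_right]
    exact (hm i a hi.1).2.trans hi.2

end ProjectiveTensor

section ApproximateInvariance

variable {S : Type} {A : Type} [NonUnitalNormedRing A] [NormedSpace ℂ A]
  (T : A ≃ₗᵢ[ℂ] lp (fun _ : S => ℂ) 1)

theorem norm_le_of_coord_le {a b : A}
    (h : ∀ s, ‖(T a : ∀ _ : S, ℂ) s‖ ≤ ‖(T b : ∀ _ : S, ℂ) s‖) : ‖a‖ ≤ ‖b‖ := by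
  rw [norm_eq_tsum_coord T a, norm_eq_tsum_coord T b]
  exact (summable_norm_coord T a).tsum_le_tsum h (summable_norm_coord T b)

theorem exists_coord_eq_norm (u : A) :
    ∃ w : A, ∀ s, (T w : ∀ _ : S, ℂ) s = (‖(T u : ∀ _ : S, ℂ) s‖ : ℂ) := by
  have hmem : Memℓp (fun s => ((‖(T u : ∀ _ : S, ℂ) s‖ : ℝ) : ℂ)) 1 :=
    memℓp_gen (by simpa using summable_norm_coord T u)
  exact ⟨T.symm ⟨_, hmem⟩, fun s => by simp⟩

/-- The `s`-th coordinate as a bounded linear functional. -/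
noncomputable def coordCLM (s : S) : A →L[ℂ] ℂ :=
  (lp.evalCLM ℂ (fun _ : S => ℂ) 1 s) ∘L (T.toContinuousLinearEquiv : A →L[ℂ] _)

theorem coordCLM_apply (s : S) (a : A) : coordCLM T s a = (T a : ∀ _ : S, ℂ) s := rfl

variable [IsScalarTower ℂ A A] [SMulCommClass ℂ A A] [Semigroup S] {star : S → S}

theorem idem_mul_mul_star_iff (h : IsCliffordStar S star) {e : S} (s t : S) :
    e * (s * t * star (s * t)) = e ↔ e * (s * star s) = e ∧ e * (t * star t) = e := by
  rw [h.mul_mul_star]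
  constructor
  · intro h1
    constructor
    · calc e * (s * star s) = e * (s * star s * (t * star t)) * (s * star s) := by rw [h1]
        _ = e * (t * star t * (s * star s) * (s * star s)) := by
          rw [h.idem_comm (h.idem_mul_star s) (h.idem_mul_star t), mul_assoc]
        _ = e * (t * star t * (s * star s)) := by
          rw [mul_assoc (t * star t), h.idem_mul_star]
        _ = e := by rw [h.idem_comm (h.idem_mul_star t) (h.idem_mul_star s), h1]
    · calc e * (t * star t) = e * (s * star s * (t * star t)) * (t * star t) := by rw [h1]
        _ = e * (s * star s * (t * star t * (t * star t))) := by simp only [mul_assoc]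
        _ = e := by rw [h.idem_mul_star, h1]
  · rintro ⟨h1, h2⟩
    rw [← mul_assoc, h1, h2]

open Classical in
/-- The functional that is one on the point masses at `s` with `e ≤ s * star s` and zero on the
others is a character. -/
theorem exists_character_of_idem (h : IsCliffordStar S star) (hA : L1SemigroupModel S A T)
    {e : S} (he : e * e = e) (L : A →L[ℂ] ℂ)
    (hL : ∀ s, L (pointMass T s) = if e * (s * star s) = e then 1 else 0) :
    ∃ φ : WeakDual.characterSpace ℂ A, ∀ a, φ a = L a := by
  have hmul1 : ∀ a t, L (a * pointMass T t) = L a * L (pointMass T t) := fun a t => by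
    have : L ∘L (ContinuousLinearMap.mul ℂ A).flip (pointMass T t) = L (pointMass T t) • L := by
      refine clm_ext_pointMass T fun s => ?_
      simp only [ContinuousLinearMap.comp_apply, ContinuousLinearMap.flip_apply,
        ContinuousLinearMap.mul_apply', smul_apply, smul_eq_mul,
        pointMass_mul T hA, hL, idem_mul_mul_star_iff h]
      split_ifs <;> simp_all
    have := congrArg (fun f => f a) this
    simpa [mul_comm] using this
  have hmul : ∀ a b, L (a * b) = L a * L b := fun a b => by
    have : L ∘L ContinuousLinearMap.mul ℂ A a = L a • L :=
      clm_ext_pointMass T fun t => by simpa using hmul1 a t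
    exact congrArg (fun f => f b) this
  refine ⟨⟨StrongDual.toWeakDual L, ?_, hmul⟩, fun a => rfl⟩
  intro h0
  have h1 : L (pointMass T e) = 0 := congrArg (fun f : WeakDual ℂ A => f (pointMass T e)) h0
  rw [hL, h.star_idem he, he, if_pos he] at h1
  exact one_ne_zero h1

open Classical in
theorem coord_pointMass_mul (h : IsCliffordStar S star) (hA : L1SemigroupModel S A T)
    {e s : S} (he : e * e = e) (hs : e * (s * star s) = e) {v : A}
    (hv : ∀ t, t * star t ≠ e → (T v : ∀ _ : S, ℂ) t = 0) (t : S) :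
    (T (pointMass T s * v) : ∀ _ : S, ℂ) t =
      if t * star t = e then (T v : ∀ _ : S, ℂ) (star s * t) else 0 := by
  have h1 := (hasSum_pointMass T v).mapL
    (coordCLM T t ∘L ContinuousLinearMap.mul ℂ A (pointMass T s))
  simp only [map_smul, ContinuousLinearMap.comp_apply, ContinuousLinearMap.mul_apply',
    pointMass_mul T hA, coordCLM_apply, coord_pointMass, smul_eq_mul] at h1
  rw [← h1.tsum_eq]
  have hfix : ∀ u, u * star u = e → s * star s * u = u := fun u hu => by
    have hu' : e * u = u := by rw [← hu, h.mul_star_mul]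
    calc s * star s * u = s * star s * e * u := by rw [mul_assoc _ e, hu']
      _ = e * (s * star s) * u := by rw [h.idem_comm he (h.idem_mul_star s)]
      _ = u := by rw [hs, hu']
  split_ifs with ht
  · rw [tsum_eq_single (star s * t)]
    · rw [← mul_assoc, hfix t ht, if_pos rfl, mul_one]
    · intro u hu
      by_cases hue : u * star u = e
      · rw [if_neg, mul_zero]
        rintro rfl
        apply hu
        rw [← mul_assoc, ← h.mul_star_comm, hfix u hue]
      · rw [hv u hue, zero_mul]
  · convert tsum_zero with u
    by_cases hue : u * star u = e
    · rw [if_neg, mul_zero]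
      rintro rfl
      apply ht
      rw [h.mul_mul_star, hue, ← h.idem_comm he (h.idem_mul_star s), hs]
    · rw [hv u hue, zero_mul]

open Classical in
/-- Approximate left amenability at the character attached to an idempotent `e` gives norm-one
approximately invariant means concentrated on the maximal subgroup at `e`. -/
theorem exists_approx_invariant (h : IsCliffordStar S star) (hA : L1SemigroupModel S A T)
    {e : S} (he : e * e = e) (L : A →L[ℂ] ℂ)
    (hL : ∀ s, L (pointMass T s) = if e * (s * star s) = e then 1 else 0)
    (φ : WeakDual.characterSpace ℂ A) (hφ : ∀ a, φ a = L a) [CompleteSpace A]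
    (ham : ApproxLeftAmenable φ) (K : Finset S) {ε : ℝ} (hε : 0 < ε) :
    ∃ w : A, ‖w‖ ≤ 1 ∧ L w = 1 ∧
      ∀ s ∈ K, e * (s * star s) = e → ‖pointMass T s * w - w‖ < ε := by
  obtain ⟨D, v, hv1, hv2⟩ := ham
  have hee : e * (e * star e) = e := by rw [h.star_idem he, he, he]
  have hLn : ∀ a, ‖L a‖ ≤ ‖a‖ := by
    obtain ⟨L', hL', hn⟩ := exists_clm_of_bounded T (fun s => L (pointMass T s)) 1
      (fun s => by rw [hL]; split_ifs <;> simp)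
    have : L' = L := clm_ext_pointMass T hL'
    simpa [this] using hn
  obtain ⟨i, hi1, hi2⟩ : ∃ i, ‖L (v i) - 1‖ < 1 / 2 ∧
      ∀ s ∈ K, ‖pointMass T s * v i - L (pointMass T s) • v i‖ < ε / 2 := by
    have e1 : ∀ᶠ i in atTop, ‖L (v i) - 1‖ < 1 / 2 := by
      have := (Metric.tendsto_nhds.1 hv2) (1 / 2) (by norm_num)
      simpa [dist_eq_norm, hφ] using this
    have e2 : ∀ᶠ i in atTop, ∀ s ∈ K,
        ‖pointMass T s * v i - L (pointMass T s) • v i‖ < ε / 2 := by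
      rw [Filter.eventually_all_finset]
      intro s _
      have := (Metric.tendsto_nhds.1 (hv1 (pointMass T s))) (ε / 2) (by positivity)
      simpa [hφ] using this
    exact (e1.and e2).exists
  obtain ⟨R, hR, hRn⟩ := exists_clm_of_bounded T
    (fun t => if e * (t * star t) = e then pointMass T (e * t) else 0) 1
    (fun t => by split_ifs <;> simp [norm_pointMass])
  have hRmul : ∀ s, e * (s * star s) = e → ∀ a,
      R (pointMass T s * a) = pointMass T s * R a := fun s hs a => by
    have : R ∘L ContinuousLinearMap.mul ℂ A (pointMass T s) =
        ContinuousLinearMap.mul ℂ A (pointMass T s) ∘L R := by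
      refine clm_ext_pointMass T fun t => ?_
      simp only [ContinuousLinearMap.comp_apply, ContinuousLinearMap.mul_apply',
        pointMass_mul T hA, hR, idem_mul_mul_star_iff h, hs, true_and]
      split_ifs
      · rw [pointMass_mul T hA, ← mul_assoc, h.idem_central he, mul_assoc]
      · simp
    exact congrArg (fun f => f a) this
  have hLR : ∀ a, L (R a) = L a := fun a => by
    have : L ∘L R = L := by
      refine clm_ext_pointMass T fun t => ?_
      simp only [ContinuousLinearMap.comp_apply, hR, hL]
      split_ifs with ht
      · rw [hL, if_pos ((idem_mul_mul_star_iff h e t).2 ⟨hee, ht⟩)]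
      · simp
    exact congrArg (fun f => f a) this
  have hRsupp : ∀ a t, t * star t ≠ e → (T (R a) : ∀ _ : S, ℂ) t = 0 := fun a t ht => by
    have : coordCLM T t ∘L R = 0 := by
      refine clm_ext_pointMass T fun u => ?_
      simp only [ContinuousLinearMap.comp_apply, hR, zero_apply]
      split_ifs with hu
      · rw [coordCLM_apply, coord_pointMass, if_neg]
        rintro rfl
        apply ht
        rw [h.mul_mul_star, h.star_idem he, he, hu]
      · simp
    exact congrArg (fun f => f a) this
  set u := R (v i) with hu
  have husupp : ∀ t, t * star t ≠ e → (T u : ∀ _ : S, ℂ) t = 0 := hRsupp _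
  obtain ⟨w, hw⟩ := exists_coord_eq_norm T u
  have hwn : ‖w‖ = ‖u‖ := by
    rw [norm_eq_tsum_coord T w, norm_eq_tsum_coord T u]
    simp [hw]
  have hwsupp : ∀ t, t * star t ≠ e → (T w : ∀ _ : S, ℂ) t = 0 := fun t ht => by
    rw [hw, hRsupp _ t ht, norm_zero, Complex.ofReal_zero]
  have hLw : L w = (‖u‖ : ℂ) := by
    have h1 := (hasSum_pointMass T w).mapL L
    have h2 : ∀ s, L ((T w : ∀ _ : S, ℂ) s • pointMass T s) =
        ((‖(T u : ∀ _ : S, ℂ) s‖ : ℝ) : ℂ) := fun s => by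
      by_cases hs : s * star s = e
      · rw [map_smul, hL, hs, if_pos he, hw, smul_eq_mul, mul_one]
      · rw [hwsupp s hs, zero_smul, map_zero, hRsupp _ s hs, norm_zero, Complex.ofReal_zero]
    simp only [h2] at h1
    rw [← h1.tsum_eq, norm_eq_tsum_coord T u, Complex.ofReal_tsum]
  have hun : 1 / 2 < ‖u‖ := by
    have h1 : ‖L u‖ ≤ ‖u‖ := hLn u
    have h2 : (1 : ℝ) ≤ ‖L (v i) - 1‖ + ‖L (v i)‖ := by
      calc (1 : ℝ) = ‖(1 : ℂ)‖ := by simp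
        _ = ‖L (v i) - (L (v i) - 1)‖ := by congr 1; ring
        _ ≤ _ := by rw [add_comm]; exact norm_sub_le _ _
    rw [hu, hLR, ← hu] at h1
    linarith
  have hu0 : ‖u‖ ≠ 0 := by linarith
  refine ⟨((‖u‖⁻¹ : ℝ) : ℂ) • w, ?_, ?_, fun s hsK hs => ?_⟩
  · rw [norm_smul, hwn]
    simp [hu0]
  · rw [map_smul, hLw, smul_eq_mul, ← Complex.ofReal_mul, inv_mul_cancel₀ hu0, Complex.ofReal_one]
  · have h1 : ‖pointMass T s * w - w‖ ≤ ‖pointMass T s * u - u‖ := by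
      refine norm_le_of_coord_le T fun t => ?_
      simp only [map_sub, lp.coeFn_sub, Pi.sub_apply,
        coord_pointMass_mul T h hA he hs hwsupp, coord_pointMass_mul T h hA he hs husupp]
      split_ifs with ht
      · rw [hw, hw, ← Complex.ofReal_sub, Complex.norm_real, Real.norm_eq_abs]
        exact abs_norm_sub_norm_le ((T u : ∀ _ : S, ℂ) (star s * t)) ((T u : ∀ _ : S, ℂ) t)
      · rw [hwsupp t ht, husupp t ht]
    have h2 : ‖pointMass T s * u - u‖ < ε / 2 := by
      have h3 := hi2 s hsK
      rw [hL, if_pos hs, one_smul] at h3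
      rw [hu, ← hRmul s hs, ← map_sub]
      exact ((hRn _).trans (by rw [one_mul])).trans_lt h3
    rw [mul_smul_comm, ← smul_sub, norm_smul, Complex.norm_real, norm_inv, norm_norm]
    rw [inv_mul_lt_iff₀ (by linarith)]
    nlinarith

end ApproximateInvariance

section Moebius

variable {S : Type} [Semigroup S] {star : S → S} {A : Type} [NonUnitalNormedRing A]
  [NormedSpace ℂ A] (T : A ≃ₗᵢ[ℂ] lp (fun _ : S => ℂ) 1)

/-- `low e` is the finite set of idempotents below the idempotent `e`. -/
structure IsLowerIdem (low : S → Finset S) : Prop where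
  mem_iff : ∀ e : S, e * e = e → ∀ f, f ∈ low e ↔ f * f = f ∧ f * e = f

theorem card_low_lt (h : IsCliffordStar S star) {low : S → Finset S} (hlow : IsLowerIdem low)
    {e f : S} (he : e * e = e) (hf : f * f = f) (hfe : f * e = f) (hne : f ≠ e) :
    (low f).card < (low e).card := by
  apply Finset.card_lt_card
  rw [Finset.ssubset_iff_of_subset]
  · refine ⟨e, (hlow.mem_iff e he e).2 ⟨he, he⟩, fun hmem => hne ?_⟩
    have := ((hlow.mem_iff f hf e).1 hmem).2
    rw [← hfe, h.idem_comm hf he, this]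
  · intro k hk
    rw [hlow.mem_iff f hf] at hk
    rw [hlow.mem_iff e he]
    refine ⟨hk.1, ?_⟩
    calc k * e = k * (f * e) := by rw [← mul_assoc, hk.2]
      _ = k := by rw [hfe, hk.2]

theorem idem_induction (h : IsCliffordStar S star) {low : S → Finset S} (hlow : IsLowerIdem low)
    {p : S → Prop}
    (ih : ∀ e, e * e = e → (∀ f, f * f = f → f * e = f → f ≠ e → p f) → p e) :
    ∀ e, e * e = e → p e := by
  intro e he
  induction hn : (low e).card using Nat.strong_induction_on generalizing e with
  | _ n hi =>
    refine ih e he fun f hf hfe hne => ?_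
    exact hi _ (hn ▸ card_low_lt h hlow he hf hfe hne) f hf rfl

/-- Möbius inversion of the point masses at idempotents. -/
theorem exists_moebius (h : IsCliffordStar S star) {low : S → Finset S}
    (hlow : IsLowerIdem low) :
    ∃ q : S → A, ∀ e, e * e = e → ∑ f ∈ low e, q f = pointMass T e := by
  classical
  let wf : WellFounded (InvImage (· < ·) fun e : S => (low e).card) := InvImage.wf _ wellFounded_lt
  let F : (e : S) → ((f : S) → InvImage (· < ·) (fun e : S => (low e).card) f e → A) → A :=
    fun e ih => pointMass T e -
      ∑ f ∈ (low e).erase e, if hf : (low f).card < (low e).card then ih f hf else 0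
  refine ⟨wf.fix F, fun e he => ?_⟩
  have hmem : e ∈ low e := (hlow.mem_iff e he e).2 ⟨he, he⟩
  rw [← Finset.add_sum_erase _ _ hmem, wf.fix_eq F e]
  have : ∑ f ∈ (low e).erase e, (if hf : (low f).card < (low e).card then wf.fix F f else 0) =
      ∑ f ∈ (low e).erase e, wf.fix F f := by
    refine Finset.sum_congr rfl fun f hf => ?_
    rw [Finset.mem_erase, hlow.mem_iff e he] at hf
    rw [dif_pos (card_low_lt h hlow he hf.2.1 hf.2.2 hf.1)]
  simp only [F]
  rw [this, sub_add_cancel]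

variable {low : S → Finset S} {q : S → A}
  (hq : ∀ e, e * e = e → ∑ f ∈ low e, q f = pointMass T e)

include hq

open Classical in
theorem moebius_eq (hlow : IsLowerIdem low) {e : S} (he : e * e = e) :
    q e = pointMass T e - ∑ f ∈ (low e).erase e, q f := by
  have hmem : e ∈ low e := (hlow.mem_iff e he e).2 ⟨he, he⟩
  rw [← hq e he, ← Finset.add_sum_erase _ _ hmem, add_sub_cancel_right]

theorem moebius_norm_le (h : IsCliffordStar S star) (hlow : IsLowerIdem low) {N : ℕ}
    (hN : ∀ e, e * e = e → (low e).card ≤ N) :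
    ∀ e, e * e = e → ‖q e‖ ≤ ((N : ℝ) + 1) ^ N := by
  classical
  have key : ∀ e, e * e = e → ‖q e‖ ≤ ((N : ℝ) + 1) ^ (low e).card := by
    refine idem_induction h hlow fun e he ih => ?_
    have hmem : e ∈ low e := (hlow.mem_iff e he e).2 ⟨he, he⟩
    obtain ⟨n, hn⟩ : ∃ n, (low e).card = n + 1 :=
      ⟨_, (Nat.succ_pred_eq_of_pos (Finset.card_pos.2 ⟨e, hmem⟩)).symm⟩
    have h1 : ∀ f ∈ (low e).erase e, ‖q f‖ ≤ ((N : ℝ) + 1) ^ n := fun f hf => by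
      rw [Finset.mem_erase, hlow.mem_iff e he] at hf
      refine (ih f hf.2.1 hf.2.2 hf.1).trans ?_
      have := card_low_lt h hlow he hf.2.1 hf.2.2 hf.1
      exact pow_le_pow_right₀ (by linarith [(Nat.cast_nonneg N : (0 : ℝ) ≤ N)]) (by omega)
    have h2 : (((low e).erase e).card : ℝ) ≤ N := by
      exact_mod_cast (Finset.card_le_card (Finset.erase_subset _ _)).trans (hN e he)
    have h3 : (1 : ℝ) ≤ ((N : ℝ) + 1) ^ n :=
      one_le_pow₀ (by linarith [(Nat.cast_nonneg N : (0 : ℝ) ≤ N)])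
    calc ‖q e‖ ≤ ‖pointMass T e‖ + ‖∑ f ∈ (low e).erase e, q f‖ := by
          rw [moebius_eq T hq hlow he]; exact norm_sub_le _ _
      _ ≤ 1 + ((low e).erase e).card * ((N : ℝ) + 1) ^ n := by
          rw [norm_pointMass]
          gcongr
          refine (norm_sum_le_of_le _ h1).trans ?_
          simp
      _ ≤ ((N : ℝ) + 1) ^ n + N * ((N : ℝ) + 1) ^ n := by gcongr
      _ = ((N : ℝ) + 1) ^ (low e).card := by rw [hn]; ring
  intro e he
  exact (key e he).trans
    (pow_le_pow_right₀ (by linarith [(Nat.cast_nonneg N : (0 : ℝ) ≤ N)]) (hN e he))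

theorem moebius_central (h : IsCliffordStar S star) (hlow : IsLowerIdem low)
    (hA : L1SemigroupModel S A T) (s : S) :
    ∀ e, e * e = e → q e * pointMass T s = pointMass T s * q e := by
  classical
  refine idem_induction h hlow fun e he ih => ?_
  rw [moebius_eq T hq hlow he, sub_mul, mul_sub, pointMass_mul T hA, pointMass_mul T hA,
    h.idem_central he, Finset.sum_mul, Finset.mul_sum]
  congr 1
  refine Finset.sum_congr rfl fun f hf => ?_
  rw [Finset.mem_erase, hlow.mem_iff e he] at hf
  exact ih f hf.2.1 hf.2.2 hf.1

open Classical in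
theorem moebius_mul_idem (h : IsCliffordStar S star) (hlow : IsLowerIdem low)
    (hA : L1SemigroupModel S A T) {k : S} (hk : k * k = k) :
    ∀ e, e * e = e → q e * pointMass T k = if e * k = e then q e else 0 := by
  refine idem_induction h hlow fun e he ih => ?_
  have h1 : ∑ f ∈ (low e).erase e, q f * pointMass T k =
      ∑ f ∈ (low e).erase e, if f * k = f then q f else 0 := by
    refine Finset.sum_congr rfl fun f hf => ?_
    rw [Finset.mem_erase, hlow.mem_iff e he] at hf
    exact ih f hf.2.1 hf.2.2 hf.1
  rw [moebius_eq T hq hlow he, sub_mul, pointMass_mul T hA, Finset.sum_mul, h1]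
  split_ifs with hek
  · rw [hek]
    congr 1
    refine Finset.sum_congr rfl fun f hf => ?_
    rw [Finset.mem_erase, hlow.mem_iff e he] at hf
    rw [if_pos]
    calc f * k = f * (e * k) := by rw [← mul_assoc, hf.2.2]
      _ = f := by rw [hek, hf.2.2]
  · rw [← Finset.sum_filter, ← hq _ (h.idem_mul he hk), sub_eq_zero]
    refine Finset.sum_congr ?_ fun _ _ => rfl
    ext f
    rw [hlow.mem_iff _ (h.idem_mul he hk), Finset.mem_filter, Finset.mem_erase, hlow.mem_iff e he]
    constructor
    · rintro ⟨hf, hfek⟩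
      have hfe : f * e = f := by
        calc f * e = f * (e * k) * e := by rw [hfek]
          _ = f * (e * (k * e)) := by simp only [mul_assoc]
          _ = f * (e * e * k) := by rw [h.idem_comm hk he, mul_assoc e]
          _ = f := by rw [he, hfek]
      have hfk : f * k = f := by
        rw [← mul_assoc, hfe] at hfek
        exact hfek
      refine ⟨⟨?_, hf, hfe⟩, hfk⟩
      rintro rfl
      exact hek hfk
    · rintro ⟨⟨-, hf, hfe⟩, hfk⟩
      exact ⟨hf, by rw [← mul_assoc, hfe, hfk]⟩

theorem moebius_mul_self (h : IsCliffordStar S star) (hlow : IsLowerIdem low)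
    (hA : L1SemigroupModel S A T) {e : S} (he : e * e = e) : q e * q e = q e := by
  classical
  nth_rewrite 2 [moebius_eq T hq hlow he]
  rw [mul_sub, moebius_mul_idem T hq h hlow hA he e he, if_pos he, Finset.mul_sum,
    Finset.sum_eq_zero, sub_zero]
  intro f hf
  rw [Finset.mem_erase, hlow.mem_iff e he] at hf
  have h1 : q f = pointMass T f * q f := by
    rw [← moebius_central T hq h hlow hA f f hf.2.1,
      moebius_mul_idem T hq h hlow hA hf.2.1 f hf.2.1, if_pos hf.2.1]
  rw [h1, ← mul_assoc, moebius_mul_idem T hq h hlow hA hf.2.1 e he, if_neg, zero_mul]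
  intro hef
  apply hf.1
  rw [← hf.2.2, h.idem_comm hf.2.1 he, hef]

theorem moebius_mul_eq_zero (h : IsCliffordStar S star) (hlow : IsLowerIdem low)
    (hA : L1SemigroupModel S A T) {e s : S} (he : e * e = e) (hs : e * (s * star s) ≠ e) :
    q e * pointMass T s = 0 := by
  have h1 : pointMass T s = pointMass T (s * star s) * pointMass T s := by
    rw [pointMass_mul T hA, h.mul_star_mul]
  rw [h1, ← mul_assoc, moebius_mul_idem T hq h hlow hA (h.idem_mul_star s) e he, if_neg hs,
    zero_mul]

theorem sum_moebius_mul_pointMass [DecidableEq S] (h : IsCliffordStar S star)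
    (hlow : IsLowerIdem low) (hA : L1SemigroupModel S A T) (F : Finset S) (s : S) :
    (∑ f ∈ F with f * f = f, q f) * pointMass T s =
      ∑ f ∈ F ∩ low (s * star s), q f * pointMass T s := by
  have hs := h.idem_mul_star s
  rw [Finset.sum_mul]
  symm
  refine Finset.sum_subset ?_ ?_
  · intro f hf
    rw [Finset.mem_inter, hlow.mem_iff _ hs] at hf
    exact Finset.mem_filter.2 ⟨hf.1, hf.2.1⟩
  · intro f hf hf2
    rw [Finset.mem_filter] at hf
    refine moebius_mul_eq_zero T hq h hlow hA hf.2 fun hfs => hf2 ?_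
    rw [Finset.mem_inter, hlow.mem_iff _ hs]
    exact ⟨hf.1, hf.2, hfs⟩

/-- The sums of the Möbius idempotents form a multiplier-bounded approximate identity. -/
theorem tendsto_sum_moebius_mul [DecidableEq S] [CompleteSpace A] [IsScalarTower ℂ A A]
    [SMulCommClass ℂ A A] (h : IsCliffordStar S star)
    (hlow : IsLowerIdem low) (hA : L1SemigroupModel S A T) {N : ℕ}
    (hN : ∀ e, e * e = e → (low e).card ≤ N) (a : A) :
    Tendsto (fun F : Finset S => (∑ f ∈ F with f * f = f, q f) * a - a) atTop (𝓝 0) := by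
  have key := tendsto_zero_of_pointMass T (l := atTop)
    (fun F : Finset S => ContinuousLinearMap.mul ℂ A (∑ f ∈ F with f * f = f, q f) -
      ContinuousLinearMap.id ℂ A) (N * ((N : ℝ) + 1) ^ N + 1) ?_ ?_ a
  · exact key
  · intro F s
    have hs := h.idem_mul_star s
    simp only [sub_apply, ContinuousLinearMap.mul_apply', ContinuousLinearMap.id_apply]
    refine (norm_sub_le _ _).trans ?_
    rw [norm_pointMass, sum_moebius_mul_pointMass T hq h hlow hA]
    gcongr
    have hterm : ∀ f ∈ F ∩ low (s * star s), ‖q f * pointMass T s‖ ≤ ((N : ℝ) + 1) ^ N :=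
      fun f hf => by
        rw [Finset.mem_inter, hlow.mem_iff _ hs] at hf
        refine (norm_mul_le _ _).trans ?_
        rw [norm_pointMass, mul_one]
        exact moebius_norm_le T hq h hlow hN f hf.2.1
    refine (norm_sum_le_of_le _ hterm).trans ?_
    rw [Finset.sum_const, nsmul_eq_mul]
    gcongr
    exact (Finset.card_le_card Finset.inter_subset_right).trans (hN _ hs)
  · intro s
    refine tendsto_const_nhds.congr' ?_
    filter_upwards [eventually_ge_atTop (low (s * star s))] with F hF
    have hs := h.idem_mul_star s
    simp only [sub_apply, ContinuousLinearMap.mul_apply', ContinuousLinearMap.id_apply]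
    rw [sum_moebius_mul_pointMass T hq h hlow hA, Finset.inter_eq_right.2 hF, ← Finset.sum_mul,
      hq _ hs, pointMass_mul T hA, h.mul_star_mul, sub_self]

end Moebius

section ApproximateDiagonal

variable {S : Type} [Semigroup S] {star : S → S} {A : Type} [NonUnitalNormedRing A]
  [NormedSpace ℂ A] (T : A ≃ₗᵢ[ℂ] lp (fun _ : S => ℂ) 1)

/-- Approximate left biprojectivity at a character that is non-zero at some central element gives
approximate left amenability at that character. -/
theorem ApproxLeftBiprojective.approxLeftAmenable {A : Type u} [NonUnitalNormedRing A]
    [NormedSpace ℂ A] [IsScalarTower ℂ A A] [SMulCommClass ℂ A A]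
    {φ : WeakDual.characterSpace ℂ A} (hφ : ApproxLeftBiprojective φ)
    {X : Type u} [NormedAddCommGroup X] [NormedSpace ℂ X] [CompleteSpace X]
    (P : ProjTensorSq A X) {z : A} (hz : ∀ a, a * z = z * a) (hz1 : φ z = 1) :
    ApproxLeftAmenable φ := by
  obtain ⟨D, ρ, h1, h2, h3⟩ := hφ X P
  refine ⟨D, fun i => P.projL (ρ i z), fun a => ?_, by simpa [hz1] using h3 z⟩
  have h4 := (P.projL.continuous.tendsto 0).comp (by simpa using (h1 a z).add (h2 a z))
  rw [map_zero] at h4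
  refine h4.congr fun i => ?_
  rw [← P.projL_lsmul, ← map_smul, ← map_sub, hz a, Function.comp_apply]
  congr 1
  abel

variable {low : S → Finset S} {q : S → A}
  (hq : ∀ e, e * e = e → ∑ f ∈ low e, q f = pointMass T e)
  {X : Type} [NormedAddCommGroup X] [NormedSpace ℂ X] [CompleteSpace X] (P : ProjTensorSq A X)

include hq

theorem lsmul_diagonal [IsScalarTower ℂ A A] [SMulCommClass ℂ A A]
    (h : IsCliffordStar S star) (hlow : IsLowerIdem low)
    (hA : L1SemigroupModel S A T) {e s : S} (he : e * e = e) (hs : e * (s * star s) = e)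
    (D : A →L[ℂ] X)
    (hD : ∀ t, D (pointMass T t) = P.tmul (q e * pointMass T t) (q e * pointMass T (star t)))
    (w : A) :
    P.lsmul (pointMass T s) (D w) = P.rsmul (pointMass T s) (D (pointMass T s * w)) := by
  classical
  have : P.lsmul (pointMass T s) ∘L D =
      P.rsmul (pointMass T s) ∘L D ∘L ContinuousLinearMap.mul ℂ A (pointMass T s) := by
    refine clm_ext_pointMass T fun t => ?_
    simp only [ContinuousLinearMap.comp_apply, ContinuousLinearMap.mul_apply',
      pointMass_mul T hA, hD, P.lsmul_tmul, P.rsmul_tmul]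
    have h1 : pointMass T s * (q e * pointMass T t) = q e * pointMass T (s * t) := by
      rw [← mul_assoc, ← moebius_central T hq h hlow hA s e he, mul_assoc, pointMass_mul T hA]
    have h2 : q e * pointMass T (star (s * t)) * pointMass T s = q e * pointMass T (star t) := by
      rw [mul_assoc, pointMass_mul T hA, h.star_mul, mul_assoc, ← h.mul_star_comm,
        ← h.idem_central (h.idem_mul_star s), ← pointMass_mul T hA, ← mul_assoc,
        moebius_mul_idem T hq h hlow hA (h.idem_mul_star s) e he, if_pos hs]
    rw [h1, h2]
  exact congrArg (fun f => f w) this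

theorem lsmul_diagonal_eq_zero (h : IsCliffordStar S star) (hlow : IsLowerIdem low)
    (hA : L1SemigroupModel S A T) {e s : S} (he : e * e = e) (hs : e * (s * star s) ≠ e)
    (D : A →L[ℂ] X)
    (hD : ∀ t, D (pointMass T t) = P.tmul (q e * pointMass T t) (q e * pointMass T (star t)))
    (w : A) : P.lsmul (pointMass T s) (D w) = 0 := by
  have : P.lsmul (pointMass T s) ∘L D = 0 := by
    refine clm_ext_pointMass T fun t => ?_
    rw [ContinuousLinearMap.comp_apply, hD, P.lsmul_tmul, ← mul_assoc,
      ← moebius_central T hq h hlow hA s e he, moebius_mul_eq_zero T hq h hlow hA he hs]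
    simp
  exact congrArg (fun f => f w) this

theorem rsmul_diagonal_eq_zero (h : IsCliffordStar S star) (hlow : IsLowerIdem low)
    (hA : L1SemigroupModel S A T) {e s : S} (he : e * e = e) (hs : e * (s * star s) ≠ e)
    (D : A →L[ℂ] X)
    (hD : ∀ t, D (pointMass T t) = P.tmul (q e * pointMass T t) (q e * pointMass T (star t)))
    (w : A) : P.rsmul (pointMass T s) (D w) = 0 := by
  have : P.rsmul (pointMass T s) ∘L D = 0 := by
    refine clm_ext_pointMass T fun t => ?_
    rw [ContinuousLinearMap.comp_apply, hD, P.rsmul_tmul, mul_assoc, pointMass_mul T hA,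
      moebius_mul_eq_zero T hq h hlow hA he fun hc =>
        hs ((idem_mul_mul_star_iff h _ _).1 hc).2]
    simp
  exact congrArg (fun f => f w) this

open Classical in
theorem projL_diagonal (h : IsCliffordStar S star) (hlow : IsLowerIdem low)
    (hA : L1SemigroupModel S A T) {e : S} (he : e * e = e) (L : A →L[ℂ] ℂ)
    (hL : ∀ s, L (pointMass T s) = if e * (s * star s) = e then 1 else 0) (D : A →L[ℂ] X)
    (hD : ∀ t, D (pointMass T t) = P.tmul (q e * pointMass T t) (q e * pointMass T (star t)))
    (w : A) : P.projL (D w) = L w • q e := by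
  have : P.projL ∘L D = L.smulRight (q e) := by
    refine clm_ext_pointMass T fun t => ?_
    rw [ContinuousLinearMap.comp_apply, hD, P.projL_tmul, ContinuousLinearMap.smulRight_apply, hL]
    have h1 : q e * pointMass T t * (q e * pointMass T (star t)) =
        q e * q e * (pointMass T t * pointMass T (star t)) := by
      rw [mul_assoc, ← mul_assoc (pointMass T t), ← moebius_central T hq h hlow hA t e he]
      simp only [mul_assoc]
    rw [h1, moebius_mul_self T hq h hlow hA he, pointMass_mul T hA,
      moebius_mul_idem T hq h hlow hA (h.idem_mul_star t) e he]
    split_ifs <;> simp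
  exact congrArg (fun f => f w) this

end ApproximateDiagonal

theorem IsCliffordStar.pseudoAmenable {S : Type} [Semigroup S] {star : S → S}
    (h : IsCliffordStar S star) {low : S → Finset S} (hlow : IsLowerIdem low) {N : ℕ}
    (hN : ∀ e, e * e = e → (low e).card ≤ N)
    {A : Type} [NonUnitalNormedRing A] [NormedSpace ℂ A]
    [IsScalarTower ℂ A A] [SMulCommClass ℂ A A] [CompleteSpace A]
    (T : A ≃ₗᵢ[ℂ] lp (fun _ : S => ℂ) 1) (hA : L1SemigroupModel S A T)
    (hbi : ApproxLeftCharBiprojective (A := A)) : PseudoAmenable (A := A) := by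
  classical
  refine pseudoAmenable_of_finite_approx fun X _ _ _ P K ε hε => ?_
  obtain ⟨q, hq⟩ := exists_moebius (A := A) T h hlow
  obtain ⟨F, hF⟩ : ∃ F : Finset S, ∀ a ∈ K, ‖(∑ f ∈ F with f * f = f, q f) * a - a‖ < ε := by
    refine Eventually.exists (f := atTop) ?_
    rw [Filter.eventually_all_finset]
    intro a _
    simpa using Metric.tendsto_nhds.1 (tendsto_sum_moebius_mul T hq h hlow hA hN a) ε hε
  choose L hL _ using fun e => exists_clm_of_bounded T
    (fun s => if e * (s * star s) = e then (1 : ℂ) else 0) 1 (fun s => by split_ifs <;> simp)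
  choose D hD hDn using fun e => exists_clm_of_bounded T
    (fun t => P.tmul (q e * pointMass T t) (q e * pointMass T (star t))) (‖q e‖ * ‖q e‖)
    (fun t => by
      have hb : ∀ t, ‖q e * pointMass T t‖ ≤ ‖q e‖ := fun t => by
        simpa [norm_pointMass] using norm_mul_le (q e) (pointMass T t)
      rw [P.norm_tmul]
      exact mul_le_mul (hb _) (hb _) (norm_nonneg _) (norm_nonneg _))
  have hinv : ∀ (i : Finset S × ℕ) (e : S), ∃ w : A, e * e = e → (‖w‖ ≤ 1 ∧ L e w = 1 ∧
      ∀ s ∈ i.1, e * (s * star s) = e → ‖pointMass T s * w - w‖ < 1 / ((i.2 : ℝ) + 1)) := by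
    intro i e
    by_cases he : e * e = e
    · obtain ⟨φ, hφ⟩ := exists_character_of_idem T h hA he (L e) (hL e)
      have hcomm : ∀ a, a * pointMass T e = pointMass T e * a := fun a => by
        have : (ContinuousLinearMap.mul ℂ A).flip (pointMass T e) =
            ContinuousLinearMap.mul ℂ A (pointMass T e) :=
          clm_ext_pointMass T fun s => by simp [pointMass_mul T hA, h.idem_central he]
        exact congrArg (fun f => f a) this
      have hone : φ (pointMass T e) = 1 := by
        rw [hφ, hL, h.star_idem he, he, if_pos he]
      obtain ⟨w, hw⟩ := exists_approx_invariant T h hA he (L e) (hL e) φ hφ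
        ((hbi φ).approxLeftAmenable P hcomm hone) i.1
        (by positivity : (0 : ℝ) < 1 / ((i.2 : ℝ) + 1))
      exact ⟨w, fun _ => hw⟩
    · exact ⟨0, fun hc => absurd hc he⟩
  choose w hw using hinv
  let m : Finset S × ℕ → X := fun i => ∑ e ∈ F with e * e = e, D e (w i e)
  have hmn : ∀ i, ‖m i‖ ≤ ∑ e ∈ F with e * e = e, ‖q e‖ * ‖q e‖ := fun i => by
    refine norm_sum_le_of_le _ fun e he => ?_
    refine (hDn e _).trans ?_
    have := (hw i e (Finset.mem_filter.1 he).2).1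
    exact mul_le_of_le_one_right (by positivity) this
  have hmp : ∀ i, P.projL (m i) = ∑ e ∈ F with e * e = e, q e := fun i => by
    rw [map_sum]
    refine Finset.sum_congr rfl fun e he => ?_
    have he' := (Finset.mem_filter.1 he).2
    rw [projL_diagonal T hq P h hlow hA he' (L e) (hL e) (D e) (hD e), (hw i e he').2.1, one_smul]
  have hwt : ∀ e s, e * e = e → e * (s * star s) = e →
      Tendsto (fun i => pointMass T s * w i e - w i e) atTop (𝓝 0) := fun e s he hs => by
    rw [Metric.tendsto_nhds]
    intro δ hδ
    filter_upwards [eventually_mem_and_one_div_lt s hδ] with i hi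
    rw [dist_zero_right]
    exact ((hw i e he).2.2 s hi.1 hs).trans hi.2
  have hcomm := tendsto_zero_of_pointMass T (l := atTop)
    (fun i => P.lsmul.flip (m i) - P.rsmul.flip (m i))
    ((‖P.lsmul‖ + ‖P.rsmul‖) * ∑ e ∈ F with e * e = e, ‖q e‖ * ‖q e‖) ?_ ?_
  · obtain ⟨i, hi⟩ : ∃ i, ∀ a ∈ K, ‖P.lsmul a (m i) - P.rsmul a (m i)‖ < ε := by
      refine Eventually.exists (f := atTop) ?_
      rw [Filter.eventually_all_finset]
      intro a _
      simpa using Metric.tendsto_nhds.1 (hcomm a) ε hε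
    exact ⟨m i, fun a ha => ⟨hi a ha, by rw [hmp]; exact hF a ha⟩⟩
  · intro i s
    simp only [sub_apply, ContinuousLinearMap.flip_apply]
    refine (norm_sub_le _ _).trans ?_
    rw [add_mul]
    have hb : ∀ B : A →L[ℂ] X →L[ℂ] X, ‖B (pointMass T s) (m i)‖ ≤
        ‖B‖ * ∑ e ∈ F with e * e = e, ‖q e‖ * ‖q e‖ := fun B => by
      refine (B.le_opNorm₂ _ _).trans ?_
      rw [norm_pointMass, mul_one]
      gcongr
      exact hmn i
    exact add_le_add (hb _) (hb _)
  · intro s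
    have hsum : ∀ i, (P.lsmul.flip (m i) - P.rsmul.flip (m i)) (pointMass T s) =
        ∑ e ∈ F with e * e = e, (P.lsmul (pointMass T s) (D e (w i e)) -
          P.rsmul (pointMass T s) (D e (w i e))) := fun i => by
      rw [sub_apply, ContinuousLinearMap.flip_apply, ContinuousLinearMap.flip_apply, map_sum,
        map_sum, Finset.sum_sub_distrib]
    simp only [hsum]
    rw [← Finset.sum_const_zero (s := F.filter fun e => e * e = e)]
    refine tendsto_finsetSum _ fun e he => ?_
    have he' := (Finset.mem_filter.1 he).2
    by_cases hs : e * (s * star s) = e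
    · have h1 := ((P.rsmul (pointMass T s) ∘L D e).continuous.tendsto 0).comp (hwt e s he' hs)
      rw [map_zero] at h1
      refine h1.congr fun i => ?_
      rw [lsmul_diagonal T hq P h hlow hA he' hs (D e) (hD e)]
      simp
    · refine tendsto_const_nhds.congr fun i => ?_
      rw [lsmul_diagonal_eq_zero T hq P h hlow hA he' hs (D e) (hD e),
        rsmul_diagonal_eq_zero T hq P h hlow hA he' hs (D e) (hD e), sub_self]

/-- Theorem 3.8.  Let `S = ⋃_{e ∈ E(S)} G_e` be a Clifford semigroup
(an inverse semigroup with `s s* = s* s`) whose idempotent semilattice `E(S)` is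
uniformly locally finite.  Then `ℓ¹(S)` is approximately left character biprojective if
and only if `ℓ¹(S)` is pseudo-amenable. -/
theorem clifford_semigroupAlgebra_approxLeftCharBiprojective_iff_pseudoAmenable
    (S : Type) [Semigroup S] (star : S → S)
    (hstar₁ : ∀ s : S, s * star s * s = s)
    (hstar₂ : ∀ s : S, star s * s * star s = star s)
    (hstar_unique : ∀ s t : S, s * t * s = s → t * s * t = t → t = star s)
    (hclifford : ∀ s : S, s * star s = star s * s)
    (hULF : ∃ N : ℕ, ∀ e : S, e * e = e →
      ({f : S | f * f = f ∧ f * e = f ∧ e * f = f}.Finite ∧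
        {f : S | f * f = f ∧ f * e = f ∧ e * f = f}.ncard ≤ N))
    (A : Type) [NonUnitalNormedRing A] [NormedSpace ℂ A]
    [IsScalarTower ℂ A A] [SMulCommClass ℂ A A] [CompleteSpace A]
    (T : A ≃ₗᵢ[ℂ] lp (fun _ : S => ℂ) 1) (hA : L1SemigroupModel S A T) :
    ApproxLeftCharBiprojective (A := A) ↔ PseudoAmenable (A := A) := by
  have h : IsCliffordStar S star := ⟨hstar₁, hstar₂, hstar_unique, hclifford⟩
  refine ⟨fun hbi => ?_, PseudoAmenable.approxLeftCharBiprojective⟩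
  classical
  obtain ⟨N, hN⟩ := hULF
  let low : S → Finset S := fun e => if he : e * e = e then (hN e he).1.toFinset else ∅
  have hlow_eq : ∀ e (he : e * e = e), low e = (hN e he).1.toFinset := fun e he => dif_pos he
  have hlow : IsLowerIdem low := ⟨fun e he f => by
    rw [hlow_eq e he, Set.Finite.mem_toFinset]
    exact ⟨fun hf => ⟨hf.1, hf.2.1⟩, fun hf => ⟨hf.1, hf.2, by rw [h.idem_comm he hf.1, hf.2]⟩⟩⟩
  refine h.pseudoAmenable hlow (N := N) (fun e he => ?_) T hA hbi
  rw [hlow_eq e he, ← Set.ncard_eq_toFinset_card _ (hN e he).1]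
  exact (hN e he).2
end

section
/- Let S be a left zero semigroup (st = s for all s,t ∈ S) with at least two elements, and let φ_S be the augmentation character on ℓ¹(S), so that fg = φ_S(g)f for all f,g ∈ ℓ¹(S). Then ℓ¹(S) is approximately left φ_S-biprojective but ℓ¹(S) is not approximately left φ_S-amenable. -/
open Filter Topology

universe u

/-- In the semigroup algebra of a left zero semigroup, `f * g = φ_S(g) f`. -/
theorem L1SemigroupModel.mul_eq_tsum_smul {S : Type} [Semigroup S] (hS : ∀ s t : S, s * t = s)
    {A : Type} [NonUnitalNormedRing A] [NormedSpace ℂ A] {T : A ≃ₗᵢ[ℂ] lp (fun _ : S => ℂ) 1}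
    (hA : L1SemigroupModel S A T) (f g : A) :
    f * g = (∑' s : S, (T g : ∀ _ : S, ℂ) s) • f := by
  apply T.injective
  ext s
  let e : S ≃ {p : S × S // p.1 * p.2 = s} :=
    { toFun := fun t => ⟨(s, t), hS s t⟩
      invFun := fun p => p.1.2
      left_inv := fun _ => rfl
      right_inv := fun ⟨⟨u, v⟩, h⟩ => by
        obtain rfl : u = s := (hS u v).symm.trans h
        rfl }
  rw [hA.mul_eq, ← e.tsum_eq, map_smul, lp.coeFn_smul, Pi.smul_apply, smul_eq_mul, mul_comm,
    ← tsum_mul_left]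
  rfl

/-- If `f * g = φ(g) f` for all `f, g`, then the algebra is approximately left
`φ`-biprojective, through the single map `x ↦ x ⊗ e` with `φ(e) = 1`. -/
theorem approxLeftBiprojective_of_mul_eq {A : Type u} [NonUnitalNormedRing A] [NormedSpace ℂ A]
    [IsScalarTower ℂ A A] [SMulCommClass ℂ A A] {φ : WeakDual.characterSpace ℂ A}
    (hmul : ∀ f g : A, f * g = φ g • f) {e : A} (he : φ e = 1) :
    ApproxLeftBiprojective φ := by
  intro X _ _ _ P
  refine ⟨⟨PUnit⟩, fun _ => P.tmul.flip e, fun a x => ?_, fun a x => ?_, fun x => ?_⟩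
  · simp [P.lsmul_tmul]
  · simp [hmul x a]
  · simp [P.projL_tmul, he]

/-- If `f * g = φ(g) f` for all `f, g` and `φ` has a nonzero kernel, then the algebra is not
approximately left `φ`-amenable. -/
theorem not_approxLeftAmenable_of_mul_eq {A : Type u} [NonUnitalNormedRing A] [NormedSpace ℂ A]
    [IsScalarTower ℂ A A] [SMulCommClass ℂ A A] {φ : WeakDual.characterSpace ℂ A}
    (hmul : ∀ f g : A, f * g = φ g • f) {a : A} (ha : a ≠ 0) (hφa : φ a = 0) :
    ¬ ApproxLeftAmenable φ := by
  rintro ⟨D, v, hv, hφv⟩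
  have hzero : Tendsto (fun i => φ (v i) • a) atTop (𝓝 0) := by
    simpa [hmul a, hφa] using hv a
  have hone : Tendsto (fun i => φ (v i) • a) atTop (𝓝 a) := by
    simpa using hφv.smul_const a
  exact ha (tendsto_nhds_unique hone hzero)

/-- Example 4.3.  Let `S` be a left zero semigroup (`s * t = s` for
all `s, t`) with at least two elements, and let `φ_S` be the augmentation character
`φ_S(f) = ∑_s f(s)` on `ℓ¹(S)` (so that `f * g = φ_S(g) f`).  Then `ℓ¹(S)` is
approximately left `φ_S`-biprojective but not approximately left `φ_S`-amenable. -/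
theorem leftZero_semigroupAlgebra_approxLeftBiprojective_not_approxLeftAmenable
    (S : Type) [Semigroup S] (hS : ∀ s t : S, s * t = s)
    (s₁ s₂ : S) (hne : s₁ ≠ s₂)
    (A : Type) [NonUnitalNormedRing A] [NormedSpace ℂ A]
    [IsScalarTower ℂ A A] [SMulCommClass ℂ A A] [CompleteSpace A]
    (T : A ≃ₗᵢ[ℂ] lp (fun _ : S => ℂ) 1) (hA : L1SemigroupModel S A T)
    (φS : WeakDual.characterSpace ℂ A)
    (hφS : ∀ f : A, φS f = ∑' s : S, (T f : ∀ _ : S, ℂ) s) :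
    ApproxLeftBiprojective φS ∧ ¬ ApproxLeftAmenable φS := by
  classical
  have hmul : ∀ f g : A, f * g = φS g • f := fun f g => by
    rw [hφS, ← hA.mul_eq_tsum_smul hS]
  let δ : S → A := fun s => T.symm (lp.single 1 s 1)
  have hδ : ∀ s, φS (δ s) = 1 := fun s => by
    simp [δ, hφS, Pi.single_apply]
  refine ⟨approxLeftBiprojective_of_mul_eq hmul (hδ s₁),
    not_approxLeftAmenable_of_mul_eq hmul (a := δ s₁ - δ s₂) (fun h => ?_) (by simp [hδ])⟩
  have h' := congrArg (fun x => (T x : ∀ _ : S, ℂ) s₁) (sub_eq_zero.mp h)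
  simp [δ, hne] at h'
end
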